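/- arXiv:2502.01876 — 4 statements merged into one kernel-verified Lean document; each statement's English description precedes it below -/
import Mathlib

section
/- Let d, K, m ≥ 1, let λ > 0 and H > 0, and let φ_{k,i} ∈ ℝ^d for k ∈ {1,…,K}, i ∈ {1,…,m} satisfy ‖φ_{k,i}‖₂ ≤ H/m. Define Σ_0 := λ I and Σ_k := λ I + ∑_{k'=1}^{k} ∑_{i=1}^{m} φ_{k',i} φ_{k',i}ᵀ for k ≥ 1 (so each Σ_k is symmetric positive definite). Then ∑_{k=1}^{K} log(1 + ∑_{i=1}^{m} φ_{k,i}ᵀ Σ_{k-1}⁻¹ φ_{k,i}) ≤ log(det(Σ_K)/det(λ I)) ≤ d·log(1 + K·H²/(λ·d·m)). -/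
open Matrix

theorem Finset.one_add_sum_le_prod_one_add_of_nonneg {ι : Type*} (s : Finset ι) (a : ι → ℝ)
    (ha : ∀ i, 0 ≤ a i) : 1 + ∑ i ∈ s, a i ≤ ∏ i ∈ s, (1 + a i) := by
  classical
  induction s using Finset.induction_on with
  | empty => simp
  | insert i s hi ih =>
    rw [Finset.sum_insert hi, Finset.prod_insert hi]
    nlinarith [mul_le_mul_of_nonneg_left ih (ha i),
      mul_nonneg (ha i) (Finset.sum_nonneg fun j (_ : j ∈ s) => ha j)]

namespace Matrix

variable {n ι : Type*} [Fintype n] [DecidableEq n] [Fintype ι] [DecidableEq ι]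

theorem IsHermitian.det_one_add_eq_prod {P : Matrix n n ℝ} (hP : P.IsHermitian) :
    (1 + P).det = ∏ i, (1 + hP.eigenvalues i) := by
  have h := congrArg (Polynomial.eval (-1)) hP.charpoly_eq
  rw [eval_charpoly, Polynomial.eval_prod] at h
  have h1 : 1 + P = -(scalar n (-1) - P) := by
    rw [map_neg, map_one, neg_sub, sub_neg_eq_add, add_comm]
  rw [h1, det_neg, h, ← Finset.card_univ, ← Finset.prod_const, ← Finset.prod_mul_distrib]
  refine Finset.prod_congr rfl fun i _ => ?_
  simp [add_comm]

theorem PosSemidef.one_add_trace_le_det_one_add {P : Matrix n n ℝ} (hP : P.PosSemidef) :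
    1 + P.trace ≤ (1 + P).det := by
  rw [hP.1.det_one_add_eq_prod, hP.1.trace_eq_sum_eigenvalues]
  exact Finset.one_add_sum_le_prod_one_add_of_nonneg _ _ hP.eigenvalues_nonneg

/-- The AM-GM inequality for the eigenvalues of a positive semidefinite matrix. -/
theorem PosSemidef.det_le_trace_div_card_pow [Nonempty n] {A : Matrix n n ℝ}
    (hA : A.PosSemidef) : A.det ≤ (A.trace / Fintype.card n) ^ Fintype.card n := by
  have h := Real.geom_mean_le_arith_mean Finset.univ (fun _ => 1) hA.1.eigenvalues
    (by simp) (by simp [Fintype.card_pos]) fun i _ => hA.eigenvalues_nonneg i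
  have hprod : 0 ≤ ∏ i, hA.1.eigenvalues i := Finset.prod_nonneg fun i _ => hA.eigenvalues_nonneg i
  simp only [Real.rpow_one, Finset.sum_const, Finset.card_univ, nsmul_eq_mul, mul_one,
    one_mul] at h
  rw [hA.1.det_eq_prod_eigenvalues, hA.1.trace_eq_sum_eigenvalues]
  calc ∏ i, hA.1.eigenvalues i
      = ((∏ i, hA.1.eigenvalues i) ^ (Fintype.card n : ℝ)⁻¹) ^ Fintype.card n :=
        (Real.rpow_inv_natCast_pow hprod Fintype.card_ne_zero).symm
    _ ≤ _ := pow_le_pow_left₀ (Real.rpow_nonneg hprod _) h _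

/-- A one-sided matrix determinant lemma for a sum of rank-one updates. -/
theorem PosDef.det_mul_one_add_sum_le {A : Matrix n n ℝ} (hA : A.PosDef) (v : ι → n → ℝ) :
    A.det * (1 + ∑ i, v i ⬝ᵥ A⁻¹ *ᵥ v i) ≤ (A + ∑ i, vecMulVec (v i) (v i)).det := by
  have hsum : ∑ i, vecMulVec (v i) (v i) = (of v)ᵀ * of v := by
    ext x y
    simp [sum_apply, vecMulVec_apply, mul_apply]
  have htrace : ∑ i, v i ⬝ᵥ A⁻¹ *ᵥ v i = (of v * A⁻¹ * (of v)ᵀ).trace := by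
    refine Finset.sum_congr rfl fun i _ => ?_
    rw [dotProduct_mulVec]
    rfl
  have hP : (of v * A⁻¹ * (of v)ᵀ).PosSemidef := by
    simpa using hA.inv.posSemidef.mul_mul_conjTranspose_same (of v)
  rw [hsum, htrace, det_add_mul _ _ hA.det_pos.ne'.isUnit]
  exact mul_le_mul_of_nonneg_left hP.one_add_trace_le_det_one_add hA.det_pos.le

end Matrix

/-- Elliptical potential / log-determinant bound: with `Σ_k = λI + ∑_{k'≤k} ∑_i φ_{k',i}φ_{k',i}ᵀ`
and `‖φ_{k,i}‖₂ ≤ H/m`, the sum of per-episode log-potential increments telescopes to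
`log(det Σ_K / det(λI))`, which is at most `d log(1 + K H² / (λ d m))`. -/
theorem log_det_potential_bound
    (d K m : ℕ) (hd : 1 ≤ d) (hK : 1 ≤ K) (hm : 1 ≤ m)
    (lam H : ℝ) (hlam : 0 < lam) (hH : 0 < H)
    (φ : Fin K → Fin m → Fin d → ℝ)
    (hφ : ∀ (k : Fin K) (i : Fin m), Real.sqrt (∑ x : Fin d, (φ k i x) ^ 2) ≤ H / m)
    (Sig : ℕ → Matrix (Fin d) (Fin d) ℝ)
    (hSig : ∀ k : ℕ, Sig k = lam • (1 : Matrix (Fin d) (Fin d) ℝ)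
        + ∑ k' : Fin K, ∑ i : Fin m,
            if (k' : ℕ) < k then Matrix.vecMulVec (φ k' i) (φ k' i) else 0) :
    (∑ k : Fin K, Real.log (1 + ∑ i : Fin m, φ k i ⬝ᵥ (Sig (k : ℕ))⁻¹ *ᵥ φ k i)
        ≤ Real.log ((Sig K).det / (lam • (1 : Matrix (Fin d) (Fin d) ℝ)).det))
    ∧ Real.log ((Sig K).det / (lam • (1 : Matrix (Fin d) (Fin d) ℝ)).det)
        ≤ (d : ℝ) * Real.log (1 + (K : ℝ) * H ^ 2 / (lam * d * m)) := by
  have hS0 : Sig 0 = lam • (1 : Matrix (Fin d) (Fin d) ℝ) := by simp [hSig]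
  have hSK : Sig K = lam • (1 : Matrix (Fin d) (Fin d) ℝ)
      + ∑ k : Fin K, ∑ i : Fin m, vecMulVec (φ k i) (φ k i) := by simp [hSig]
  have hpd (k : ℕ) : (Sig k).PosDef := by
    rw [hSig]
    refine (PosDef.one.smul hlam).add_posSemidef
      (posSemidef_sum _ fun k' _ => posSemidef_sum _ fun i _ => ?_)
    split_ifs
    · simpa using posSemidef_vecMulVec_self_star (φ k' i)
    · exact .zero
  have hstep (k : Fin K) :
      Sig (k + 1) = Sig k + ∑ i : Fin m, vecMulVec (φ k i) (φ k i) := by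
    rw [hSig, hSig, add_assoc]
    congr 1
    rw [← Fintype.sum_ite_eq k fun k' => ∑ i : Fin m, vecMulVec (φ k' i) (φ k' i),
      ← Finset.sum_add_distrib]
    refine Finset.sum_congr rfl fun k' _ => ?_
    rcases lt_trichotomy k' k with h | rfl | h
    · simp [h.ne', h, Nat.lt_succ_of_lt h]
    · simp
    · have h' : ¬ (k' : ℕ) < k + 1 := by omega
      have h'' : ¬ k' < k := h.not_gt
      simp [h.ne, h', h'']
  rw [← hS0]
  constructor
  · calc ∑ k : Fin K, Real.log (1 + ∑ i : Fin m, φ k i ⬝ᵥ (Sig k)⁻¹ *ᵥ φ k i)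
        ≤ ∑ k : Fin K, (Real.log (Sig (k + 1)).det - Real.log (Sig k).det) := by
          refine Finset.sum_le_sum fun k _ => ?_
          have hsum : 0 ≤ ∑ i : Fin m, φ k i ⬝ᵥ (Sig k)⁻¹ *ᵥ φ k i :=
            Finset.sum_nonneg fun i _ => by
              simpa using (hpd k).inv.posSemidef.dotProduct_mulVec_nonneg (φ k i)
          have hdet := (hpd k).det_mul_one_add_sum_le (φ k)
          rw [← hstep] at hdet
          rw [le_sub_iff_add_le', ← Real.log_mul (hpd k).det_pos.ne' (by positivity)]
          exact Real.log_le_log (mul_pos (hpd k).det_pos (by positivity)) hdet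
      _ = Real.log (Sig K).det - Real.log (Sig 0).det := by
          rw [Fin.sum_univ_eq_sum_range
            fun k => Real.log (Sig (k + 1)).det - Real.log (Sig k).det]
          exact Finset.sum_range_sub (fun k => Real.log (Sig k).det) K
      _ = _ := (Real.log_div (hpd K).det_pos.ne' (hpd 0).det_pos.ne').symm
  · have : Nonempty (Fin d) := ⟨⟨0, hd⟩⟩
    have hd0 : (0 : ℝ) < d := by exact_mod_cast hd
    have hm0 : (0 : ℝ) < m := by exact_mod_cast hm
    have htr : (Sig K).trace ≤ d * lam + K * H ^ 2 / m := by
      have hb (k : Fin K) (i : Fin m) : (vecMulVec (φ k i) (φ k i)).trace ≤ (H / m) ^ 2 := by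
        rw [trace_vecMulVec]
        simpa [dotProduct, sq] using (Real.sqrt_le_left (by positivity)).mp (hφ k i)
      have hsum : ∑ k : Fin K, ∑ i : Fin m, (vecMulVec (φ k i) (φ k i)).trace
          ≤ ∑ _k : Fin K, ∑ _i : Fin m, (H / m) ^ 2 :=
        Finset.sum_le_sum fun k _ => Finset.sum_le_sum fun i _ => hb k i
      have hconst : ∑ _k : Fin K, ∑ _i : Fin m, (H / m) ^ 2 = K * H ^ 2 / m := by
        simp
        field_simp
      rw [hSK, trace_add, trace_smul, trace_one, trace_sum]
      simp only [trace_sum, Fintype.card_fin, smul_eq_mul]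
      linarith
    have hdet := (hpd K).posSemidef.det_le_trace_div_card_pow
    rw [Fintype.card_fin] at hdet
    have hdet0 : (Sig 0).det = lam ^ d := by simp [hS0]
    rw [← Real.log_pow]
    refine Real.log_le_log (div_pos (hpd K).det_pos (hpd 0).det_pos) ?_
    rw [hdet0, div_le_iff₀ (by positivity), ← mul_pow]
    refine hdet.trans (pow_le_pow_left₀ (div_nonneg (hpd K).posSemidef.trace_nonneg hd0.le) ?_ _)
    rw [div_le_iff₀ hd0]
    refine htr.trans_eq ?_
    field_simp
end

section
/- Let d, K, m ≥ 1 with K₀ ∈ {0,…,K−1}, let λ > 0 and H > 0, and let φ_{k,i} ∈ ℝ^d for k ∈ {1,…,K}, i ∈ {1,…,m} satisfy ‖φ_{k,i}‖₂ ≤ H/m. Define Σ_0 := λ I and Σ_k := λ I + ∑_{k'=1}^{k} ∑_{i=1}^{m} φ_{k',i} φ_{k',i}ᵀ. If for every k ∈ {K₀+1,…,K} one has ∑_{i=1}^{m} φ_{k,i}ᵀ Σ_{k-1}⁻¹ φ_{k,i} ≤ 1, then ∑_{k=K₀+1}^{K} ∑_{i=1}^{m} √(φ_{k,i}ᵀ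 Σ_{k-1}⁻¹ φ_{k,i}) ≤ √( 2·K·m·d · log(1 + K·H²/(λ·d·m)) ). -/
open Matrix

/-- A positive semidefinite real matrix satisfies `1 + tr M ≤ det (1 + M)`. -/
lemma Matrix.PosSemidef.one_add_trace_le_det_one_add_s9 {n : Type*} [Fintype n] [DecidableEq n]
    {M : Matrix n n ℝ} (hM : M.PosSemidef) : 1 + M.trace ≤ (1 + M).det := by
  have hdet : (1 + M).det = ∏ i, (1 + hM.1.eigenvalues i) := by
    conv_lhs => rw [hM.1.spectral_theorem, Unitary.conjStarAlgAut_apply, Matrix.mul_assoc,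
      det_one_add_mul_comm, Matrix.mul_assoc, Unitary.coe_star_mul_self, Matrix.mul_one,
      ← diagonal_one, diagonal_add, det_diagonal]
    rfl
  have key : ∀ s : Finset n, 1 + ∑ i ∈ s, hM.1.eigenvalues i ≤
      ∏ i ∈ s, (1 + hM.1.eigenvalues i) := by
    intro s
    induction s using Finset.induction_on with
    | empty => simp
    | insert a s ha ih =>
      rw [Finset.sum_insert ha, Finset.prod_insert ha]
      have h0 := hM.eigenvalues_nonneg a
      have h1 : 0 ≤ ∑ i ∈ s, hM.1.eigenvalues i :=
        Finset.sum_nonneg fun i _ => hM.eigenvalues_nonneg i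
      nlinarith [mul_nonneg h0 h1, mul_le_mul_of_nonneg_left ih h0]
  rw [hdet, hM.1.trace_eq_sum_eigenvalues]
  exact key Finset.univ

/-- The log-determinant form of the AM-GM inequality for positive definite matrices. -/
lemma Matrix.PosDef.log_det_le {n : Type*} [Fintype n] [DecidableEq n]
    {S : Matrix n n ℝ} (hS : S.PosDef) {c : ℝ} (hc : 0 < c)
    (htr : S.trace ≤ Fintype.card n * c) :
    Real.log S.det ≤ Fintype.card n * Real.log c := by
  rw [hS.1.trace_eq_sum_eigenvalues] at htr
  rw [hS.1.det_eq_prod_eigenvalues]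
  simp only [RCLike.ofReal_real_eq_id, id_eq] at htr ⊢
  rw [Real.log_prod fun i _ => (hS.eigenvalues_pos i).ne']
  calc ∑ i, Real.log (hS.1.eigenvalues i)
      ≤ ∑ i, (Real.log c + (hS.1.eigenvalues i / c - 1)) := by
        refine Finset.sum_le_sum fun i _ => ?_
        have h := Real.log_le_sub_one_of_pos (div_pos (hS.eigenvalues_pos i) hc)
        rw [Real.log_div (hS.eigenvalues_pos i).ne' hc.ne'] at h
        linarith
    _ = Fintype.card n * Real.log c + ((∑ i, hS.1.eigenvalues i) / c - Fintype.card n) := by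
        simp [Finset.sum_add_distrib, Finset.sum_div]
    _ ≤ Fintype.card n * Real.log c := by
        have := (div_le_iff₀ hc).2 htr
        linarith

lemma Matrix.sum_vecMulVec_self {ι n : Type*} [Fintype ι] (v : ι → n → ℝ) :
    ∑ i, vecMulVec (v i) (v i) = (of v)ᵀ * of v := by
  ext a b
  simp [Matrix.sum_apply, vecMulVec_apply, mul_apply]

/-- Adding outer products `v i (v i)ᵀ` to a positive definite matrix `S` increases `log det` by at
least `log (1 + ∑ i, (v i)ᵀ S⁻¹ (v i))`. -/
lemma Matrix.PosDef.log_one_add_sum_le_log_det_sub {ι n : Type*} [Fintype ι]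
    [Fintype n] [DecidableEq n] {S : Matrix n n ℝ} (hS : S.PosDef) (v : ι → n → ℝ) :
    Real.log (1 + ∑ i, v i ⬝ᵥ S⁻¹ *ᵥ v i) ≤
      Real.log (S + ∑ i, vecMulVec (v i) (v i)).det - Real.log S.det := by
  classical
  have hM : (of v * S⁻¹ * (of v)ᵀ).PosSemidef := by
    simpa using hS.inv.posSemidef.mul_mul_conjTranspose_same (of v)
  have htr : (of v * S⁻¹ * (of v)ᵀ).trace = ∑ i, v i ⬝ᵥ S⁻¹ *ᵥ v i := by
    refine Finset.sum_congr rfl fun i _ => ?_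
    rw [diag_apply, dotProduct_mulVec]
    rfl
  have hle := hM.one_add_trace_le_det_one_add_s9
  have hnn := hM.trace_nonneg
  rw [sum_vecMulVec_self, det_add_mul _ _ hS.det_pos.ne'.isUnit,
    Real.log_mul hS.det_pos.ne' (by linarith), ← htr]
  have := Real.log_le_log (by linarith) hle
  linarith

lemma Real.le_two_mul_log_one_add {x : ℝ} (h0 : 0 ≤ x) (h1 : x ≤ 1) :
    x ≤ 2 * Real.log (1 + x) := by
  have h := Real.le_log_one_add_of_nonneg h0
  have h2 : x / 2 ≤ 2 * x / (x + 2) := by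
    rw [div_le_div_iff₀ (by norm_num) (by linarith)]
    nlinarith
  linarith

lemma Real.sum_sqrt_le_sqrt_card_mul_sum {ι : Type*} [Fintype ι] {f : ι → ℝ}
    (hf : ∀ i, 0 ≤ f i) : ∑ i, √(f i) ≤ √(Fintype.card ι * ∑ i, f i) := by
  refine Real.le_sqrt_of_sq_le ?_
  simpa [Real.sq_sqrt (hf _)] using
    sq_sum_le_card_mul_sum_sq (s := Finset.univ) (f := fun i => √(f i))

/-- Elliptical potential with optimized initialization: if after episode `K₀` every per-episode
potential `∑_i φ_{k,i}ᵀ Σ_{k-1}⁻¹ φ_{k,i}` is at most `1`, then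
`∑_{k=K₀+1}^{K} ∑_i ‖φ_{k,i}‖_{Σ_{k-1}⁻¹} ≤ √(2Kmd · log(1 + KH²/(λdm)))`. -/
theorem sum_seg_norm_bound_after_exploration
    (d K m K₀ : ℕ) (hd : 1 ≤ d) (hK : 1 ≤ K) (hm : 1 ≤ m) (hK₀ : K₀ < K)
    (lam H : ℝ) (hlam : 0 < lam) (hH : 0 < H)
    (φ : Fin K → Fin m → Fin d → ℝ)
    (hφ : ∀ (k : Fin K) (i : Fin m), Real.sqrt (∑ x : Fin d, (φ k i x) ^ 2) ≤ H / m)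
    (Sig : ℕ → Matrix (Fin d) (Fin d) ℝ)
    (hSig : ∀ k : ℕ, Sig k = lam • (1 : Matrix (Fin d) (Fin d) ℝ)
        + ∑ k' : Fin K, ∑ i : Fin m,
            if (k' : ℕ) < k then Matrix.vecMulVec (φ k' i) (φ k' i) else 0)
    (hpot : ∀ k : Fin K, K₀ ≤ (k : ℕ) →
        ∑ i : Fin m, φ k i ⬝ᵥ (Sig (k : ℕ))⁻¹ *ᵥ φ k i ≤ 1) :
    ∑ k : Fin K, (if K₀ ≤ (k : ℕ) then
        ∑ i : Fin m, Real.sqrt (φ k i ⬝ᵥ (Sig (k : ℕ))⁻¹ *ᵥ φ k i) else 0)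
      ≤ Real.sqrt (2 * K * m * d * Real.log (1 + (K : ℝ) * H ^ 2 / (lam * d * m))) := by
  have hd' : (0 : ℝ) < d := by exact_mod_cast hd
  have hm' : (0 : ℝ) < m := by exact_mod_cast hm
  have hstep : ∀ k : Fin K,
      Sig (k + 1) = Sig k + ∑ i, vecMulVec (φ k i) (φ k i) := by
    intro k
    rw [hSig, hSig, add_assoc]
    congr 1
    have hsingle : ∑ i, vecMulVec (φ k i) (φ k i) =
        ∑ k' : Fin K, if k' = k then ∑ i, vecMulVec (φ k' i) (φ k' i) else 0 := by simp
    rw [hsingle, ← Finset.sum_add_distrib]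
    refine Finset.sum_congr rfl fun k' _ => ?_
    rcases lt_trichotomy k' k with h | h | h
    · have h1 : (k' : ℕ) < k := h
      simp [h1, h.ne, h1.trans (Nat.lt_succ_self _)]
    · subst h
      simp
    · have h1 : ¬ (k' : ℕ) < k := not_lt.2 h.le
      have h2 : ¬ (k' : ℕ) < k + 1 := by
        have : (k : ℕ) < k' := h
        omega
      simp [h1, h2, h.ne']
  have hpd : ∀ k, (Sig k).PosDef := by
    intro k
    rw [hSig]
    refine (PosDef.one.smul hlam).add_posSemidef ?_
    refine posSemidef_sum _ fun k' _ => posSemidef_sum _ fun i _ => ?_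
    split_ifs
    · simpa using posSemidef_vecMulVec_self_star (φ k' i)
    · exact PosSemidef.zero
  have hnonneg : ∀ (k : Fin K) i, 0 ≤ φ k i ⬝ᵥ (Sig k)⁻¹ *ᵥ φ k i := fun k i => by
    simpa using (hpd k).inv.posSemidef.dotProduct_mulVec_nonneg (φ k i)
  have hnorm : ∀ (k : Fin K) i, φ k i ⬝ᵥ φ k i ≤ (H / m) ^ 2 := by
    intro k i
    have h := (Real.sqrt_le_left (by positivity)).1 (hφ k i)
    simpa [dotProduct, ← sq] using h
  set c : ℝ := lam * (1 + (K : ℝ) * H ^ 2 / (lam * d * m)) with hc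
  have hc0 : 0 < c := by positivity
  have htrace : (Sig K).trace ≤ Fintype.card (Fin d) * c := by
    have hsum : ∑ k : Fin K, ∑ i : Fin m, φ k i ⬝ᵥ φ k i ≤ K * (m * (H / m) ^ 2) := by
      calc _ ≤ ∑ k : Fin K, ∑ i : Fin m, (H / m) ^ 2 :=
            Finset.sum_le_sum fun k _ => Finset.sum_le_sum fun i _ => hnorm k i
        _ = _ := by simp
    have hval : (Sig K).trace = d * lam + ∑ k : Fin K, ∑ i : Fin m, φ k i ⬝ᵥ φ k i := by
      rw [hSig]
      simp [trace_sum, trace_vecMulVec, mul_comm]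
    rw [hval, Fintype.card_fin, hc]
    have : (d : ℝ) * (lam * (1 + K * H ^ 2 / (lam * d * m))) =
        d * lam + K * (m * (H / m) ^ 2) := by
      field_simp
    linarith
  have hlogK : Real.log (Sig K).det ≤
      d * Real.log lam + d * Real.log (1 + (K : ℝ) * H ^ 2 / (lam * d * m)) := by
    have h := (hpd K).log_det_le hc0 htrace
    rw [Fintype.card_fin, hc, Real.log_mul hlam.ne' (by positivity)] at h
    linarith
  have hlog0 : Real.log (Sig 0).det = d * Real.log lam := by
    rw [hSig]
    simp
  have hpotential : ∀ k : Fin K,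
      (if K₀ ≤ (k : ℕ) then ∑ i, φ k i ⬝ᵥ (Sig k)⁻¹ *ᵥ φ k i else 0) ≤
        2 * (Real.log (Sig (k + 1)).det - Real.log (Sig k).det) := by
    intro k
    have h := (hpd k).log_one_add_sum_le_log_det_sub (φ k)
    rw [← hstep] at h
    have hp : 0 ≤ ∑ i, φ k i ⬝ᵥ (Sig k)⁻¹ *ᵥ φ k i := Finset.sum_nonneg fun i _ => hnonneg k i
    split_ifs with hk
    · linarith [Real.le_two_mul_log_one_add hp (hpot k hk)]
    · linarith [Real.log_nonneg (le_add_of_nonneg_right hp)]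
  have htotal : ∑ k : Fin K, (if K₀ ≤ (k : ℕ) then ∑ i, φ k i ⬝ᵥ (Sig k)⁻¹ *ᵥ φ k i else 0) ≤
      2 * (d * Real.log (1 + (K : ℝ) * H ^ 2 / (lam * d * m))) := by
    refine (Finset.sum_le_sum fun k _ => hpotential k).trans ?_
    rw [← Finset.mul_sum,
      Fin.sum_univ_eq_sum_range (fun k => Real.log (Sig (k + 1)).det - Real.log (Sig k).det) K,
      Finset.sum_range_sub (fun k => Real.log (Sig k).det)]
    linarith
  have hcs := Real.sum_sqrt_le_sqrt_card_mul_sum (ι := Fin K × Fin m)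
    (f := fun p => if K₀ ≤ (p.1 : ℕ) then φ p.1 p.2 ⬝ᵥ (Sig p.1)⁻¹ *ᵥ φ p.1 p.2 else 0)
    (fun p => by
      split_ifs
      exacts [hnonneg _ _, le_rfl])
  simp only [Fintype.sum_prod_type, Fintype.card_prod, Fintype.card_fin, Nat.cast_mul] at hcs
  have hleft : ∀ k : Fin K, (if K₀ ≤ (k : ℕ) then
        ∑ i : Fin m, Real.sqrt (φ k i ⬝ᵥ (Sig k)⁻¹ *ᵥ φ k i) else 0) =
      ∑ i, √(if K₀ ≤ (k : ℕ) then φ k i ⬝ᵥ (Sig k)⁻¹ *ᵥ φ k i else 0) := by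
    intro k
    split_ifs <;> simp
  have hright : ∀ k : Fin K, (if K₀ ≤ (k : ℕ) then
        ∑ i, φ k i ⬝ᵥ (Sig k)⁻¹ *ᵥ φ k i else 0) =
      ∑ i, if K₀ ≤ (k : ℕ) then φ k i ⬝ᵥ (Sig k)⁻¹ *ᵥ φ k i else 0 := by
    intro k
    split_ifs <;> simp
  simp only [hright] at htotal
  simp only [hleft]
  refine hcs.trans (Real.sqrt_le_sqrt ?_)
  have hKm : (0 : ℝ) ≤ K * m := by positivity
  linarith [mul_le_mul_of_nonneg_left htotal hKm]
end

section
/- Let μ′(y) = 1/(exp(y) + exp(−y) + 2) denote the derivative of the sigmoid function μ(y) = 1/(1 + exp(−y)). For every real x ≥ 0 and every c ∈ (0, 1), one has (1/4)·exp((1 − 2c)·x) ≤ μ′(x)/(μ′((1−c)·x))² ≤ 16·exp((1 − 2c)·x). -/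
/-- The derivative of the sigmoid function: `μ′(y) = 1/(exp y + exp (−y) + 2)`. -/
noncomputable def sigmoidDeriv (y : ℝ) : ℝ := 1 / (Real.exp y + Real.exp (-y) + 2)

theorem sigmoidDeriv_pos (y : ℝ) : 0 < sigmoidDeriv y := by
  unfold sigmoidDeriv
  positivity

theorem sigmoidDeriv_le_exp_neg (y : ℝ) : sigmoidDeriv y ≤ Real.exp (-y) := by
  rw [sigmoidDeriv, Real.exp_neg, ← one_div]
  exact one_div_le_one_div_of_le (Real.exp_pos y) (by linarith [one_div_pos.2 (Real.exp_pos y)])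

theorem exp_neg_div_four_le_sigmoidDeriv {y : ℝ} (hy : 0 ≤ y) :
    Real.exp (-y) / 4 ≤ sigmoidDeriv y := by
  have h₁ : 1 ≤ Real.exp y := Real.one_le_exp hy
  have h₂ : Real.exp (-y) ≤ 1 := Real.exp_le_one_iff.2 (by linarith)
  have h₃ : Real.exp (-y) / 4 = 1 / (4 * Real.exp y) := by
    rw [Real.exp_neg]
    field_simp
  rw [h₃, sigmoidDeriv]
  exact one_div_le_one_div_of_le (by positivity) (by linarith)

/-- For `x ≥ 0` and `c ∈ (0,1)`,
`(1/4) exp((1−2c)x) ≤ μ′(x)/(μ′((1−c)x))² ≤ 16 exp((1−2c)x)`. -/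
theorem sigmoidDeriv_ratio_exp_bounds
    (x c : ℝ) (hx : 0 ≤ x) (hc0 : 0 < c) (hc1 : c < 1) :
    (1 / 4) * Real.exp ((1 - 2 * c) * x)
        ≤ sigmoidDeriv x / (sigmoidDeriv ((1 - c) * x)) ^ 2
      ∧ sigmoidDeriv x / (sigmoidDeriv ((1 - c) * x)) ^ 2
        ≤ 16 * Real.exp ((1 - 2 * c) * x) := by
  have hy : 0 ≤ (1 - c) * x := mul_nonneg (by linarith) hx
  have hpos := sigmoidDeriv_pos ((1 - c) * x)
  have hexp : Real.exp ((1 - 2 * c) * x) * Real.exp (-((1 - c) * x)) ^ 2 = Real.exp (-x) := by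
    rw [← Real.exp_nat_mul, ← Real.exp_add]
    congr 1
    push_cast
    ring
  constructor
  · rw [le_div_iff₀ (by positivity)]
    calc 1 / 4 * Real.exp ((1 - 2 * c) * x) * sigmoidDeriv ((1 - c) * x) ^ 2
        ≤ 1 / 4 * Real.exp ((1 - 2 * c) * x) * Real.exp (-((1 - c) * x)) ^ 2 := by
          gcongr
          exact sigmoidDeriv_le_exp_neg _
      _ = Real.exp (-x) / 4 := by rw [← hexp]; ring
      _ ≤ sigmoidDeriv x := exp_neg_div_four_le_sigmoidDeriv hx
  · rw [div_le_iff₀ (by positivity)]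
    calc sigmoidDeriv x ≤ Real.exp (-x) := sigmoidDeriv_le_exp_neg x
      _ = 16 * Real.exp ((1 - 2 * c) * x) * (Real.exp (-((1 - c) * x)) / 4) ^ 2 := by
          rw [← hexp]; ring
      _ ≤ 16 * Real.exp ((1 - 2 * c) * x) * sigmoidDeriv ((1 - c) * x) ^ 2 := by
          gcongr
          exact exp_neg_div_four_le_sigmoidDeriv hy
end

section
/- Let K ≥ 1 and H > 0, let w_1, …, w_K be real numbers with 0 ≤ w_k ≤ H for every k, and set S_k := ∑_{k'=1}^{k} w_{k'}. Then ∑_{k=1}^{K} 1{S_k ≥ H}·(w_k/S_k) ≤ 1 + log K, where 1{·} is the indicator of the stated condition. -/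
/-- Potential argument: the indicator-weighted sum of ratios vanishes while the partial sums stay
below `H`, and is at most `1 + log (S / H)` once the partial sum `S` has reached `H`. -/
theorem sum_indicator_ratio_le_potential {H : ℝ} (hH : 0 < H) {w : ℕ → ℝ}
    (hw0 : ∀ k, 0 ≤ w k) (n : ℕ) :
    ∑ k ∈ Finset.Icc 1 n,
        (if H ≤ (∑ k' ∈ Finset.Icc 1 k, w k')
          then w k / (∑ k' ∈ Finset.Icc 1 k, w k') else 0)
      ≤ if H ≤ ∑ k ∈ Finset.Icc 1 n, w k
          then 1 + Real.log ((∑ k ∈ Finset.Icc 1 n, w k) / H) else 0 := by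
  induction n with
  | zero => simp [hH.not_ge]
  | succ n ih =>
    rw [Finset.sum_Icc_succ_top (Nat.le_add_left 1 n)]
    have hS : ∑ k ∈ Finset.Icc 1 (n + 1), w k = ∑ k ∈ Finset.Icc 1 n, w k + w (n + 1) :=
      Finset.sum_Icc_succ_top (Nat.le_add_left 1 n) w
    have hT : 0 ≤ ∑ k ∈ Finset.Icc 1 n, w k := Finset.sum_nonneg fun k _ => hw0 k
    have hw := hw0 (n + 1)
    rw [hS]
    generalize ∑ k ∈ Finset.Icc 1 n, w k = T at *
    by_cases h : H ≤ T + w (n + 1)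
    · have hpos : 0 < T + w (n + 1) := hH.trans_le h
      rw [if_pos h, if_pos h]
      by_cases hTH : H ≤ T
      · have hTpos : 0 < T := hH.trans_le hTH
        rw [if_pos hTH] at ih
        have hlog := Real.one_sub_inv_le_log_of_pos (div_pos hpos hTpos)
        have hratio : 1 - ((T + w (n + 1)) / T)⁻¹ = w (n + 1) / (T + w (n + 1)) := by
          field_simp
          ring
        rw [hratio, Real.log_div hpos.ne' hTpos.ne'] at hlog
        rw [Real.log_div hTpos.ne' hH.ne'] at ih
        rw [Real.log_div hpos.ne' hH.ne']
        linarith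
      · rw [if_neg hTH] at ih
        have hratio : w (n + 1) / (T + w (n + 1)) ≤ 1 := by
          rw [div_le_one hpos]
          linarith
        have hlog : 0 ≤ Real.log ((T + w (n + 1)) / H) :=
          Real.log_nonneg ((one_le_div hH).2 h)
        linarith
    · have hTH : ¬ H ≤ T := fun hle => h (by linarith)
      rw [if_neg hTH] at ih
      rw [if_neg h, if_neg h]
      linarith

/-- With `S_k = ∑_{k'=1}^{k} w_{k'}` and `0 ≤ w_k ≤ H`, the visitation-ratio potential satisfies
`∑_{k=1}^{K} 1{S_k ≥ H} (w_k / S_k) ≤ 1 + log K`. -/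
theorem sum_indicator_ratio_le_one_add_log
    (K : ℕ) (hK : 1 ≤ K) (H : ℝ) (hH : 0 < H)
    (w : ℕ → ℝ) (hw0 : ∀ k, 0 ≤ w k) (hwH : ∀ k, w k ≤ H) :
    ∑ k ∈ Finset.Icc 1 K,
        (if H ≤ (∑ k' ∈ Finset.Icc 1 k, w k')
          then w k / (∑ k' ∈ Finset.Icc 1 k, w k') else 0)
      ≤ 1 + Real.log K := by
  have hlogK : 0 ≤ Real.log K := Real.log_natCast_nonneg K
  refine (sum_indicator_ratio_le_potential hH hw0 K).trans ?_
  split_ifs with h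
  · have hS : ∑ k ∈ Finset.Icc 1 K, w k ≤ K * H := by
      simpa using Finset.sum_le_card_nsmul (Finset.Icc 1 K) w H fun k _ => hwH k
    have hlog := Real.log_le_log (div_pos (hH.trans_le h) hH) ((div_le_iff₀ hH).2 hS)
    linarith
  · linarith
end
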